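/- Let β > 0 and F₀ > 4β be constants, and take supercritical external force F(N) = F₀·N. Let λ₀ = λ₀(β,F₀) be the unique real number satisfying ∫₀¹ x·e^{λ₀x − β/x} dx = (1 − √(4β/F₀))·∫₀¹ e^{λ₀x − β/x} dx. Then there exist a constant C > 0 and N₀ ∈ ℕ such that for all N ≥ N₀ and all integers 2 ≤ k ≤ N, | m_k(N, F₀N) − √( β / ((k−1)·F₀·N + λ₀) ) | ≤ C·(log N)/(kN)^{3/4}. -/

import Mathlib

open MeasureTheory Filter

noncomputable section

/-- The `k`-th spacing coordinate (for `1 ≤ k ≤ N`): for `k ≤ N-1` it is the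
`k`-th coordinate of `x`, and for `k = N` it is `1 - (x_1 + ⋯ + x_{N-1})`. -/
def coulombCoord (N k : ℕ) (x : Fin (N - 1) → ℝ) : ℝ :=
  if h : k - 1 < N - 1 then x ⟨k - 1, h⟩ else 1 - ∑ i, x i

/-- The open simplex `T_N ⊆ (0,1)^{N-1}`. -/
def coulombDomain (N : ℕ) : Set (Fin (N - 1) → ℝ) :=
  {x | (∀ i, 0 < x i ∧ x i < 1) ∧ ∑ i, x i < 1}

/-- `I_N[g] = ∫_{T_N} g · exp(−Σ_{i=1}^N (β/x_i + F·i·x_i))`. -/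
def coulombInt (β F : ℝ) (N : ℕ) (g : (Fin (N - 1) → ℝ) → ℝ) : ℝ :=
  ∫ x in coulombDomain N,
    g x * Real.exp (-(∑ k ∈ Finset.Icc 1 N,
      (β / coulombCoord N k x + F * (k : ℝ) * coulombCoord N k x)))

/-- Conditional mean `m_k(N,F)` of the `k`-th spacing. -/
def condMean (β : ℝ) (N : ℕ) (F : ℝ) (k : ℕ) : ℝ :=
  coulombInt β F N (coulombCoord N k) / coulombInt β F N (fun _ => 1)

/-- Conditional variance `v_k(N,F)` of the `k`-th spacing. -/
def condVar (β : ℝ) (N : ℕ) (F : ℝ) (k : ℕ) : ℝ :=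
  coulombInt β F N (fun x => coulombCoord N k x ^ 2) / coulombInt β F N (fun _ => 1)
    - condMean β N F k ^ 2


def cE (β a t : ℝ) : ℝ := Real.exp (-(β / t + a * t))

lemma cE_pos (β a t : ℝ) : 0 < cE β a t := Real.exp_pos _

lemma cE_meas (β a : ℝ) : Measurable (cE β a) := by
  unfold cE; fun_prop

lemma cE_le {β a t : ℝ} (hβ : 0 < β) (ht : 0 < t) : cE β a t ≤ Real.exp (-a * t) := by
  unfold cE
  apply Real.exp_le_exp.mpr
  have : 0 < β / t := by positivity
  linarith

lemma cE_inv_le {β a t : ℝ} (hβ : 0 < β) (ht : 0 < t) :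
    t⁻¹ * cE β a t ≤ β⁻¹ * Real.exp (-a * t) := by
  have h1 : cE β a t = Real.exp (-(β / t)) * Real.exp (-a * t) := by
    unfold cE; rw [← Real.exp_add]; congr 1; ring
  rw [h1, ← mul_assoc]
  apply mul_le_mul_of_nonneg_right _ (Real.exp_pos _).le
  rw [Real.exp_neg]
  have h2 : β / t < Real.exp (β / t) := by
    have := Real.add_one_le_exp (β / t); linarith
  have h3 : 0 < β / t := by positivity
  calc t⁻¹ * (Real.exp (β / t))⁻¹ ≤ t⁻¹ * (β / t)⁻¹ := by gcongr
    _ = β⁻¹ := by field_simp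

lemma int_base {a : ℝ} (ha : 0 < a) (n : ℕ) :
    IntegrableOn (fun t : ℝ => t ^ n * Real.exp (-a * t)) (Set.Ioi 0) := by
  have := integrableOn_rpow_mul_exp_neg_mul_rpow (p := 1) (s := n) (b := a)
    (by have : (0:ℝ) ≤ n := Nat.cast_nonneg n
        linarith) one_pos ha
  simpa using this

lemma int_pow {β a : ℝ} (hβ : 0 < β) (ha : 0 < a) (n : ℕ) :
    IntegrableOn (fun t : ℝ => t ^ n * cE β a t) (Set.Ioi 0) := by
  refine Integrable.mono' (int_base ha n) ?_ ?_
  · exact ((measurable_id.pow_const n).mul (cE_meas β a)).aestronglyMeasurable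
  · filter_upwards [ae_restrict_mem measurableSet_Ioi] with t ht
    have ht : 0 < t := ht
    rw [Real.norm_of_nonneg (mul_nonneg (by positivity) (cE_pos _ _ _).le)]
    exact mul_le_mul_of_nonneg_left (cE_le hβ ht) (by positivity)

lemma int_inv {β a : ℝ} (hβ : 0 < β) (ha : 0 < a) :
    IntegrableOn (fun t : ℝ => t⁻¹ * cE β a t) (Set.Ioi 0) := by
  have h := (int_base ha 0).const_mul β⁻¹
  refine Integrable.mono' h ?_ ?_
  · exact ((measurable_id.inv).mul (cE_meas β a)).aestronglyMeasurable
  · filter_upwards [ae_restrict_mem measurableSet_Ioi] with t ht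
    have ht : 0 < t := ht
    rw [Real.norm_of_nonneg (mul_nonneg (by positivity) (cE_pos _ _ _).le)]
    simpa using cE_inv_le hβ ht

lemma cE_deriv {β a t : ℝ} (ht : 0 < t) :
    HasDerivAt (cE β a) ((β / t ^ 2 - a) * cE β a t) t := by
  have h1 : HasDerivAt (fun t : ℝ => -(β / t + a * t)) (β / t ^ 2 - a) t := by
    have := (((hasDerivAt_inv ht.ne').const_mul β).add ((hasDerivAt_id t).const_mul a)).neg
    exact this.congr_deriv (by field_simp; ring)
  have := h1.exp
  unfold cE
  convert this using 1
  ring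

lemma ibp {β a : ℝ} (hβ : 0 < β) (ha : 0 < a) (n : ℕ) :
    ∫ t in Set.Ioi (0:ℝ), ((n + 1) * t ^ n * cE β a t
      + t ^ (n + 1) * ((β / t ^ 2 - a) * cE β a t)) = 0 := by
  have hderivInt : IntegrableOn (fun t : ℝ => ((n + 1) * t ^ n * cE β a t
      + t ^ (n + 1) * ((β / t ^ 2 - a) * cE β a t))) (Set.Ioi 0) := by
    have hm : IntegrableOn (fun t : ℝ => t ^ (n + 1) * (t ^ 2)⁻¹ * cE β a t) (Set.Ioi 0) := by
      rcases n with _ | n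
      · refine (int_inv hβ ha).congr_fun (fun t ht => ?_) measurableSet_Ioi
        have ht : 0 < t := ht
        simp only
        congr 1
        field_simp
        simp
      · refine (int_pow hβ ha n).congr_fun (fun t ht => ?_) measurableSet_Ioi
        have ht : 0 < t := ht
        simp only
        congr 1
        field_simp
        ring
    have := (((int_pow hβ ha n).const_mul (n + 1 : ℝ)).add (hm.const_mul β)).sub
      ((int_pow hβ ha (n + 1)).const_mul a)
    refine this.congr (ae_of_all _ fun t => ?_)
    simp only [Pi.add_apply, Pi.sub_apply]
    ring
  have key := integral_Ioi_of_hasDerivAt_of_tendsto (a := 0) (m := 0)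
    (f := fun t : ℝ => t ^ (n + 1) * cE β a t) ?_ ?_ hderivInt ?_
  · rw [key]; simp
  · -- continuity
    have : Tendsto (fun t : ℝ => t ^ (n + 1) * Real.exp (-a * t)) (nhdsWithin 0 (Set.Ici 0))
        (nhds 0) := by
      have : Continuous (fun t : ℝ => t ^ (n + 1) * Real.exp (-a * t)) := by fun_prop
      have h := this.tendsto 0
      simp only [ne_eq, Nat.add_eq_zero_iff, one_ne_zero, and_false, not_false_eq_true, zero_pow,
        zero_mul] at h
      exact h.mono_left nhdsWithin_le_nhds
    unfold ContinuousWithinAt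
    simp only [ne_eq, Nat.add_eq_zero_iff, one_ne_zero, and_false, not_false_eq_true, zero_pow,
        zero_mul]
    refine squeeze_zero' ?_ ?_ this
    · filter_upwards [self_mem_nhdsWithin] with t ht
      have ht : 0 ≤ t := ht
      exact mul_nonneg (by positivity) (cE_pos _ _ _).le
    · filter_upwards [self_mem_nhdsWithin] with t ht
      rcases (show 0 ≤ t from ht).eq_or_lt with rfl | h
      · simp
      · exact mul_le_mul_of_nonneg_left (cE_le hβ h) (by positivity)
  · intro t ht
    have := (hasDerivAt_pow (n + 1) t).mul (cE_deriv (β := β) (a := a) ht)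
    exact this.congr_deriv (by push_cast; simp)
  · have := tendsto_rpow_mul_exp_neg_mul_atTop_nhds_zero ((n + 1 : ℕ) : ℝ) a ha
    simp only [Real.rpow_natCast] at this
    refine squeeze_zero' ?_ ?_ this
    · filter_upwards [eventually_gt_atTop 0] with t ht
      exact mul_nonneg (by positivity) (cE_pos _ _ _).le
    · filter_upwards [eventually_gt_atTop 0] with t ht
      exact mul_le_mul_of_nonneg_left (cE_le hβ ht) (by positivity)

/-- One-dimensional estimate. -/
lemma one_dim {β a : ℝ} (hβ : 0 < β) (ha : 0 < a) (hab : 1 ≤ a * Real.sqrt (β / a)) :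
    ∫ t in Set.Ioi (0:ℝ), |t - Real.sqrt (β / a)| * cE β a t
      ≤ (Real.sqrt β + 1 / 2) * a ^ (-(3:ℝ)/4) * ∫ t in Set.Ioi (0:ℝ), cE β a t := by
  set r := Real.sqrt (β / a) with hr
  have hr2 : r ^ 2 = β / a := Real.sq_sqrt (by positivity)
  have hβr : β = a * r ^ 2 := by rw [hr2]; field_simp
  have hrpos : 0 < r := Real.sqrt_pos.mpr (by positivity)
  have i0 : IntegrableOn (fun t : ℝ => cE β a t) (Set.Ioi 0) := by simpa using int_pow hβ ha 0
  have i1 : IntegrableOn (fun t : ℝ => t * cE β a t) (Set.Ioi 0) := by simpa using int_pow hβ ha 1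
  have i2 := int_pow hβ ha 2
  have im := int_inv hβ ha
  set Z := ∫ t in Set.Ioi (0:ℝ), cE β a t with hZ
  set M1 := ∫ t in Set.Ioi (0:ℝ), t * cE β a t with hM1
  set M2 := ∫ t in Set.Ioi (0:ℝ), t ^ 2 * cE β a t with hM2
  set Mm := ∫ t in Set.Ioi (0:ℝ), t⁻¹ * cE β a t with hMm
  have e1 : Z + β * Mm - a * M1 = 0 := by
    rw [← ibp hβ ha 0, hZ, hM1, hMm, ← integral_const_mul, ← integral_const_mul, ← integral_add,
      ← integral_sub]
    · refine setIntegral_congr_fun measurableSet_Ioi fun t ht => ?_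
      have ht : 0 < t := ht
      simp only [Nat.cast_zero, pow_zero]
      field_simp
      ring
    · exact i0.add (im.const_mul β)
    · exact i1.const_mul a
    · exact i0
    · exact im.const_mul β
  have e2 : 2 * M1 + β * Z - a * M2 = 0 := by
    rw [← ibp hβ ha 1, hZ, hM1, hM2, ← integral_const_mul, ← integral_const_mul,
      ← integral_const_mul, ← integral_add, ← integral_sub]
    · refine setIntegral_congr_fun measurableSet_Ioi fun t ht => ?_
      have ht : 0 < t := ht
      simp only [Nat.cast_one, pow_one]
      field_simp
      ring
    · exact (i1.const_mul 2).add (i0.const_mul β)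
    · exact i2.const_mul a
    · exact i1.const_mul 2
    · exact i0.const_mul β
  have e3 : 0 ≤ M1 - 2 * r * Z + r ^ 2 * Mm := by
    have : M1 - 2 * r * Z + r ^ 2 * Mm
        = ∫ t in Set.Ioi (0:ℝ), (t - r) ^ 2 * t⁻¹ * cE β a t := by
      rw [hZ, hM1, hMm, ← integral_const_mul, ← integral_const_mul, ← integral_sub, ← integral_add]
      · refine setIntegral_congr_fun measurableSet_Ioi fun t ht => ?_
        have ht : 0 < t := ht
        field_simp
        ring
      · exact i1.sub (i0.const_mul (2 * r))
      · exact im.const_mul (r ^ 2)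
      · exact i1
      · exact i0.const_mul (2 * r)
    rw [this]
    refine setIntegral_nonneg measurableSet_Ioi fun t ht => ?_
    have ht : 0 < t := ht
    exact mul_nonneg (by positivity) (cE_pos _ _ _).le
  have hZ0 : 0 ≤ Z := setIntegral_nonneg measurableSet_Ioi fun t _ => (cE_pos _ _ _).le
  have e4 : r * Z ≤ M1 := by
    have h1 : a * (r ^ 2 * Mm) = a * M1 - Z := by rw [hβr] at e1; linarith
    have h2 : 0 ≤ a * (M1 - 2 * r * Z + r ^ 2 * Mm) := mul_nonneg ha.le e3
    have h3 : 0 ≤ 2 * a * (M1 - r * Z) := by nlinarith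
    have h4 := nonneg_of_mul_nonneg_right h3 (by positivity)
    linarith
  have e5 : a * (M2 - 2 * r * M1 + r ^ 2 * Z) ≤ 2 * r * Z := by
    have h := mul_nonneg (sub_nonneg.mpr hab) (sub_nonneg.mpr e4)
    have h2 : a * M2 = 2 * M1 + a * r ^ 2 * Z := by rw [← hβr]; linarith
    nlinarith
  set σ := a ^ (-(3:ℝ)/4) with hσ
  have hσpos : 0 < σ := Real.rpow_pos_of_pos ha _
  have hσ2 : r / a = Real.sqrt β * σ ^ 2 := by
    have h1 : σ ^ 2 = a ^ (-(3:ℝ)/2) := by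
      rw [hσ, ← Real.rpow_natCast, ← Real.rpow_mul ha.le]; norm_num
    have h2 : a ^ (-(3:ℝ)/2) = (Real.sqrt a)⁻¹ * a⁻¹ := by
      rw [Real.sqrt_eq_rpow, ← Real.rpow_neg_one a, ← Real.rpow_neg ha.le, ← Real.rpow_add ha]
      norm_num
    rw [h1, h2, hr, Real.sqrt_div hβ.le]
    field_simp
  have e6 : ∫ t in Set.Ioi (0:ℝ), |t - r| * cE β a t
      ≤ (2 * σ)⁻¹ * (M2 - 2 * r * M1 + r ^ 2 * Z) + σ / 2 * Z := by
    have hi : IntegrableOn (fun t : ℝ => (t - r) ^ 2 * cE β a t) (Set.Ioi 0) := by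
      refine (((i2.sub (i1.const_mul (2 * r))).add (i0.const_mul (r ^ 2)))).congr
        (ae_of_all _ fun t => ?_)
      simp only [Pi.add_apply, Pi.sub_apply]
      ring
    have h1 : M2 - 2 * r * M1 + r ^ 2 * Z
        = ∫ t in Set.Ioi (0:ℝ), (t - r) ^ 2 * cE β a t := by
      rw [hZ, hM1, hM2, ← integral_const_mul, ← integral_const_mul, ← integral_sub, ← integral_add]
      · refine setIntegral_congr_fun measurableSet_Ioi fun t ht => ?_
        ring
      · exact i2.sub (i1.const_mul (2 * r))
      · exact i0.const_mul (r ^ 2)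
      · exact i2
      · exact i1.const_mul (2 * r)
    rw [h1, hZ, ← integral_const_mul, ← integral_const_mul, ← integral_add]
    · refine integral_mono_of_nonneg (ae_of_all _ fun t => mul_nonneg (abs_nonneg _)
        (cE_pos _ _ _).le) ((hi.const_mul _).add (i0.const_mul _)) (ae_of_all _ fun t => ?_)
      simp only
      rw [← mul_assoc, ← add_mul]
      refine mul_le_mul_of_nonneg_right ?_ (cE_pos _ _ _).le
      have h := sq_nonneg (|t - r| - σ)
      rw [sub_sq, sq_abs] at h
      rw [inv_mul_eq_div, div_add' _ _ _ (by positivity), le_div_iff₀ (by positivity)]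
      nlinarith
    · exact hi.const_mul _
    · exact i0.const_mul _
  have e7 : M2 - 2 * r * M1 + r ^ 2 * Z ≤ 2 * Real.sqrt β * σ ^ 2 * Z := by
    have : M2 - 2 * r * M1 + r ^ 2 * Z ≤ 2 * (r / a) * Z := by
      have h := (le_div_iff₀' ha).mpr e5
      calc _ ≤ _ := h
        _ = _ := by ring
    rw [hσ2] at this
    linarith
  calc _ ≤ _ := e6
    _ ≤ (2 * σ)⁻¹ * (2 * Real.sqrt β * σ ^ 2 * Z) + σ / 2 * Z := by gcongr
    _ = _ := by field_simp

lemma Z_pos {β a : ℝ} (hβ : 0 < β) (ha : 0 < a) : 0 < ∫ t in Set.Ioi (0:ℝ), cE β a t := by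
  have i0 : IntegrableOn (fun t : ℝ => cE β a t) (Set.Ioi 0) := by simpa using int_pow hβ ha 0
  rw [setIntegral_pos_iff_support_of_nonneg_ae (ae_of_all _ fun t => (cE_pos _ _ _).le) i0]
  have : Function.support (fun t => cE β a t) = Set.univ := by
    ext t; simp [(cE_pos β a t).ne']
  rw [this]; simp

lemma prod_one_int {n : ℕ} (q : Fin n → ℝ → ℝ) (f : ℝ → ℝ) (j : Fin n)
    (hq : ∀ i, Integrable (q i)) (hf : Integrable (fun t => f t * q j t)) :
    Integrable (fun y : Fin n → ℝ => f (y j) * ∏ i, q i (y i)) ∧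
    ∫ y : Fin n → ℝ, f (y j) * ∏ i, q i (y i)
      = (∫ t, f t * q j t) * ∏ i ∈ Finset.univ.erase j, ∫ t, q i t := by
  classical
  have h1 : (fun y : Fin n → ℝ => f (y j) * ∏ i, q i (y i))
      = fun y => ∏ i, (Function.update q j (fun t => f t * q j t)) i (y i) := by
    funext y
    rw [← Finset.mul_prod_erase _ _ (Finset.mem_univ j),
      ← Finset.mul_prod_erase _ _ (Finset.mem_univ j), ← mul_assoc, Function.update_self]
    congr 1
    refine Finset.prod_congr rfl fun i hi => ?_
    rw [Function.update_of_ne (Finset.ne_of_mem_erase hi)]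
  rw [h1]
  constructor
  · refine Integrable.fintype_prod (f := Function.update q j (fun t => f t * q j t)) fun i => ?_
    by_cases h : i = j
    · subst h; simpa using hf
    · rw [Function.update_of_ne h]; exact hq i
  · rw [integral_fintype_prod_volume_eq_prod (Function.update q j (fun t => f t * q j t)),
      ← Finset.mul_prod_erase _ _ (Finset.mem_univ j), Function.update_self]
    congr 1
    refine Finset.prod_congr rfl fun i hi => ?_
    rw [Function.update_of_ne (Finset.ne_of_mem_erase hi)]

def cW (β s : ℝ) : ℝ := if s < 1 then Real.exp (-(β / (1 - s))) else 0

lemma cW_meas (β : ℝ) : Measurable (cW β) := by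
  unfold cW
  exact Measurable.ite measurableSet_Iio (by fun_prop) measurable_const

lemma cW_nonneg (β s : ℝ) : 0 ≤ cW β s := by
  unfold cW; split_ifs
  · exact (Real.exp_pos _).le
  · exact le_rfl

lemma cW_le {β : ℝ} (hβ : 0 < β) (s : ℝ) : cW β s ≤ 1 := by
  unfold cW; split_ifs with h
  · rw [Real.exp_le_one_iff]
    have : 0 < β / (1 - s) := div_pos hβ (by linarith)
    linarith
  · exact zero_le_one

lemma cW_lower {β δ : ℝ} (hβ : 0 < β) (hδ : 0 < δ) (hδ1 : δ < 1) {s : ℝ} (hs : 0 ≤ s) :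
    Real.exp (-(β / δ)) * (1 - s / (1 - δ)) ≤ cW β s := by
  by_cases h : s ≤ 1 - δ
  · unfold cW
    rw [if_pos (by linarith)]
    have h1 : 0 ≤ s / (1 - δ) := div_nonneg hs (by linarith)
    have h2 : β / (1 - s) ≤ β / δ := by
      apply div_le_div_of_nonneg_left hβ.le hδ; linarith
    have h3 : Real.exp (-(β / δ)) ≤ Real.exp (-(β / (1 - s))) := Real.exp_le_exp.mpr (by linarith)
    have := Real.exp_pos (-(β / δ))
    nlinarith
  · refine le_trans ?_ (cW_nonneg β s)
    push Not at h
    have : 1 < s / (1 - δ) := by rw [lt_div_iff₀ (by linarith)]; linarith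
    have h2 := Real.exp_pos (-(β / δ))
    nlinarith

lemma abstract_bound {n : ℕ} {β δ : ℝ} (hβ : 0 < β) (hδ : 0 < δ) (hδ1 : δ < 1)
    (q : Fin n → ℝ → ℝ) (r e : Fin n → ℝ)
    (hq0 : ∀ i t, 0 ≤ q i t) (hqs : ∀ i t, t ≤ 0 → q i t = 0)
    (hq : ∀ i, Integrable (q i)) (hq1 : ∀ i, Integrable (fun t => t * q i t))
    (hZ : ∀ i, 0 < ∫ t, q i t)
    (hr : ∀ i, ∫ t, |t - r i| * q i t ≤ e i * ∫ t, q i t)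
    (hsum : ∑ i, (r i + e i) ≤ 1 - 2 * δ) (j : Fin n) :
    |(∫ y : Fin n → ℝ, y j * (cW β (∑ i, y i) * ∏ i, q i (y i))) /
      (∫ y : Fin n → ℝ, cW β (∑ i, y i) * ∏ i, q i (y i)) - r j|
      ≤ e j / (Real.exp (-(β / δ)) * δ) := by
  set P : (Fin n → ℝ) → ℝ := fun y => ∏ i, q i (y i) with hP
  set Z := ∏ i, ∫ t, q i t with hZdef
  have hZpos : 0 < Z := Finset.prod_pos fun i _ => hZ i
  have hP0 : ∀ y, 0 ≤ P y := fun y => Finset.prod_nonneg fun i _ => hq0 i _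
  have hPi : Integrable P := Integrable.fintype_prod hq
  have hPint : ∫ y, P y = Z := integral_fintype_prod_volume_eq_prod q
  have hsplit : ∀ j, (∫ t, q j t) * ∏ i ∈ Finset.univ.erase j, ∫ t, q i t = Z := fun j =>
    Finset.mul_prod_erase Finset.univ (fun i => ∫ t, q i t) (Finset.mem_univ j)
  have hpp : ∀ j, 0 < ∏ i ∈ Finset.univ.erase j, ∫ t, q i t := fun j =>
    Finset.prod_pos fun i _ => hZ i
  have hW : Measurable fun y : Fin n → ℝ => cW β (∑ i, y i) :=
    (cW_meas β).comp (by fun_prop)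
  have hWb : ∀ᵐ y : Fin n → ℝ, ‖cW β (∑ i, y i)‖ ≤ 1 := ae_of_all _ fun y => by
    rw [Real.norm_of_nonneg (cW_nonneg _ _)]; exact cW_le hβ _
  have hWi : ∀ g : (Fin n → ℝ) → ℝ, Integrable g →
      Integrable (fun y => cW β (∑ i, y i) * g y) := fun g hg =>
    hg.bdd_mul hW.aestronglyMeasurable hWb
  -- coordinate integrals
  have hai : ∀ i, Integrable (fun t => |t - r i| * q i t) := fun i => by
    have := ((hq1 i).sub ((hq i).const_mul (r i))).abs
    refine this.congr (ae_of_all _ fun t => ?_)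
    simp only [Pi.sub_apply]
    rw [← sub_mul, abs_mul, abs_of_nonneg (hq0 i t)]
  have hA : ∀ i, Integrable (fun y : Fin n → ℝ => |y i - r i| * P y) ∧
      ∫ y : Fin n → ℝ, |y i - r i| * P y ≤ e i * Z := fun i => by
    obtain ⟨h1, h2⟩ := prod_one_int q (fun t => |t - r i|) i hq (hai i)
    refine ⟨h1, ?_⟩
    rw [h2, ← hsplit i, ← mul_assoc]
    exact mul_le_mul_of_nonneg_right (hr i) (hpp i).le
  have hB : ∀ i, Integrable (fun y : Fin n → ℝ => y i * P y) := fun i =>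
    (prod_one_int q (fun t => t) i hq (hq1 i)).1
  have hBle : ∀ i, ∫ y : Fin n → ℝ, y i * P y ≤ (r i + e i) * Z := fun i => by
    have : ∫ y : Fin n → ℝ, y i * P y ≤ ∫ y : Fin n → ℝ, (r i * P y + |y i - r i| * P y) := by
      refine integral_mono (hB i) ((hPi.const_mul _).add (hA i).1) fun y => ?_
      simp only
      rw [← add_mul]
      refine mul_le_mul_of_nonneg_right ?_ (hP0 y)
      have := le_abs_self (y i - r i)
      linarith
    rw [integral_add (hPi.const_mul _) (hA i).1, integral_const_mul, hPint] at this
    have h2 := (hA i).2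
    linarith
  set D := ∫ y : Fin n → ℝ, cW β (∑ i, y i) * P y with hD
  have hDlow : Real.exp (-(β / δ)) * δ * Z ≤ D := by
    have hSi : Integrable (fun y : Fin n → ℝ => (∑ i, y i * P y)) :=
      integrable_finsetSum _ fun i _ => hB i
    have hlow : ∫ y : Fin n → ℝ, Real.exp (-(β / δ)) * (P y - (1 - δ)⁻¹ * ∑ i, y i * P y) ≤ D := by
      refine integral_mono ((hPi.sub (hSi.const_mul _)).const_mul _) (hWi P hPi) fun y => ?_
      simp only
      by_cases hy : ∀ i, 0 < y i
      · have hs : 0 ≤ ∑ i, y i := Finset.sum_nonneg fun i _ => (hy i).le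
        have := mul_le_mul_of_nonneg_right (cW_lower hβ hδ hδ1 hs) (hP0 y)
        refine le_trans (le_of_eq ?_) this
        rw [← Finset.sum_mul]
        ring
      · push Not at hy
        obtain ⟨i, hi⟩ := hy
        have : P y = 0 := Finset.prod_eq_zero (Finset.mem_univ i) (hqs i _ hi)
        simp [this]
    rw [integral_const_mul, integral_sub hPi (hSi.const_mul _), integral_const_mul,
      integral_finsetSum _ fun i _ => hB i, hPint] at hlow
    have hS : ∑ i, ∫ y : Fin n → ℝ, y i * P y ≤ (1 - 2 * δ) * Z := by
      calc _ ≤ ∑ i, (r i + e i) * Z := Finset.sum_le_sum fun i _ => hBle i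
        _ = (∑ i, (r i + e i)) * Z := by rw [Finset.sum_mul]
        _ ≤ _ := by gcongr
    refine le_trans ?_ hlow
    rw [mul_assoc]
    refine mul_le_mul_of_nonneg_left ?_ (Real.exp_pos _).le
    have h1 : (1 - δ)⁻¹ * ∑ i, ∫ y : Fin n → ℝ, y i * P y ≤ (1 - δ)⁻¹ * ((1 - 2 * δ) * Z) :=
      mul_le_mul_of_nonneg_left hS (inv_nonneg.mpr (by linarith))
    have h2 : (1 - δ)⁻¹ * (1 - 2 * δ) ≤ 1 - δ := by
      rw [inv_mul_le_iff₀ (by linarith)]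
      nlinarith
    have h3 := mul_le_mul_of_nonneg_right h2 hZpos.le
    linarith
  have hcpos : 0 < Real.exp (-(β / δ)) * δ := mul_pos (Real.exp_pos _) hδ
  have hDpos : 0 < D := lt_of_lt_of_le (mul_pos hcpos hZpos) hDlow
  have hnum : (∫ y : Fin n → ℝ, y j * (cW β (∑ i, y i) * P y)) - r j * D
      = ∫ y : Fin n → ℝ, (y j - r j) * (cW β (∑ i, y i) * P y) := by
    rw [hD, ← integral_const_mul, ← integral_sub]
    · congr 1; funext y; ring
    · refine (hWi _ (hB j)).congr (ae_of_all _ fun y => ?_)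
      simp only; ring
    · exact (hWi _ hPi).const_mul _
  have hnb : |∫ y : Fin n → ℝ, (y j - r j) * (cW β (∑ i, y i) * P y)| ≤ e j * Z := by
    refine le_trans (abs_integral_le_integral_abs) (le_trans ?_ (hA j).2)
    refine integral_mono_of_nonneg (ae_of_all _ fun y => abs_nonneg _) (hA j).1
      (ae_of_all _ fun y => ?_)
    simp only
    rw [abs_mul]
    refine mul_le_mul_of_nonneg_left ?_ (abs_nonneg _)
    rw [abs_of_nonneg (mul_nonneg (cW_nonneg _ _) (hP0 y))]
    exact mul_le_of_le_one_left (hP0 y) (cW_le hβ _)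
  rw [div_sub' hDpos.ne', abs_div, abs_of_pos hDpos, mul_comm D, hnum]
  have hej : 0 ≤ e j := by
    have := le_trans (abs_nonneg _) hnb
    exact nonneg_of_mul_nonneg_left this hZpos
  rw [div_le_div_iff₀ hDpos hcpos]
  calc _ ≤ e j * Z * (Real.exp (-(β / δ)) * δ) := by gcongr
    _ = e j * (Real.exp (-(β / δ)) * δ * Z) := by ring
    _ ≤ e j * D := by gcongr

def cPhi (m : ℕ) (x : Fin (m + 1) → ℝ) : Fin (m + 1) → ℝ :=
  Fin.cons (1 - ∑ i, x i) (fun i : Fin m => x i.succ)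

lemma cPhi_zero (m : ℕ) (x : Fin (m + 1) → ℝ) : cPhi m x 0 = 1 - ∑ i, x i := rfl

lemma cPhi_succ (m : ℕ) (x : Fin (m + 1) → ℝ) (i : Fin m) : cPhi m x i.succ = x i.succ := rfl

lemma cPhi_sum (m : ℕ) (x : Fin (m + 1) → ℝ) : 1 - ∑ i, cPhi m x i = x 0 := by
  rw [Fin.sum_univ_succ, cPhi_zero, Fin.sum_univ_succ]
  simp only [cPhi_succ]
  ring

lemma cPhi_inv (m : ℕ) : Function.Involutive (cPhi m) := by
  intro x
  funext i
  refine Fin.cases ?_ (fun i => ?_) i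
  · rw [cPhi_zero, cPhi_sum]
  · rfl

lemma cPhi_mp (m : ℕ) : MeasurePreserving (cPhi m) volume volume := by
  have h1 := volume_preserving_piFinSuccAbove (fun _ : Fin (m + 1) => ℝ) 0
  have h2 : MeasurePreserving
      (fun p : (Fin m → ℝ) × ℝ => (p.1, (1 - ∑ i, p.1 i) - p.2)) (volume.prod volume)
        (volume.prod volume) := by
    refine MeasurePreserving.skew_product (f := id) (g := fun (a : Fin m → ℝ) (t : ℝ) => (1 - ∑ i, a i) - t)
      (MeasurePreserving.id _) ?_ ?_
    · unfold Function.uncurry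
      fun_prop
    · refine ae_of_all _ fun a => ?_
      exact (Measure.measurePreserving_sub_left volume (1 - ∑ i, a i)).map_eq
  have h3 : MeasurePreserving (Prod.swap : ℝ × (Fin m → ℝ) → _) (volume.prod volume)
    (volume.prod volume) := Measure.measurePreserving_swap
  have h4 : MeasurePreserving (Prod.swap : (Fin m → ℝ) × ℝ → _) (volume.prod volume)
    (volume.prod volume) := Measure.measurePreserving_swap
  have h5 := ((MeasurePreserving.symm _ h1).comp (h4.comp (h2.comp (h3.comp h1))))
  refine (?_ : cPhi m = _) ▸ h5
  funext x
  funext i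
  refine Fin.cases ?_ (fun i => ?_) i
  · rw [cPhi_zero, Fin.sum_univ_succ]
    simp [MeasurableEquiv.piFinSuccAbove, Fin.insertNthEquiv, Fin.tail]
    ring
  · simp [MeasurableEquiv.piFinSuccAbove, Fin.insertNthEquiv, cPhi_succ, Fin.tail]

lemma coord_one (m : ℕ) (y : Fin (m + 1) → ℝ) :
    coulombCoord (m + 2) 1 (cPhi m y) = 1 - ∑ i, y i := by
  unfold coulombCoord
  rw [dif_pos (by omega)]
  rfl

lemma coord_mid (m : ℕ) (y : Fin (m + 1) → ℝ) (i : Fin m) :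
    coulombCoord (m + 2) (i + 2) (cPhi m y) = y i.succ := by
  unfold coulombCoord
  rw [dif_pos (by omega)]
  rfl

lemma coord_last (m : ℕ) (y : Fin (m + 1) → ℝ) :
    coulombCoord (m + 2) (m + 2) (cPhi m y) = y 0 := by
  unfold coulombCoord
  rw [dif_neg (by omega)]
  exact cPhi_sum m y

lemma sum_split (m : ℕ) (f : ℕ → ℝ) :
    ∑ k ∈ Finset.Icc 1 (m + 2), f k = f 1 + (f (m + 2) + ∑ i : Fin m, f (i + 2)) := by
  induction m with
  | zero => simp [Finset.sum_Icc_succ_top]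
  | succ m ih =>
    rw [Finset.sum_Icc_succ_top (by omega), ih, Fin.sum_univ_castSucc]
    simp only [Fin.val_castSucc, Fin.val_last]
    ring_nf

def cB (m : ℕ) (i : Fin (m + 1)) : ℝ := if i = 0 then (m + 1 : ℝ) else (i : ℕ)

def cq (β F : ℝ) (m : ℕ) (i : Fin (m + 1)) : ℝ → ℝ :=
  (Set.Ioi (0:ℝ)).indicator (cE β (F * cB m i))

lemma exponent (β F : ℝ) (m : ℕ) (y : Fin (m + 1) → ℝ) :
    (∑ k ∈ Finset.Icc 1 (m + 2), (β / coulombCoord (m + 2) k (cPhi m y)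
      + F * (k : ℝ) * coulombCoord (m + 2) k (cPhi m y)))
    = F + β / (1 - ∑ i, y i) + ∑ i, (β / y i + F * cB m i * y i) := by
  rw [sum_split, coord_one, coord_last, Fin.sum_univ_succ (fun i => β / y i + F * cB m i * y i)]
  have h : ∀ i : Fin m, (β / coulombCoord (m + 2) (i + 2) (cPhi m y)
      + F * ((i + 2 : ℕ) : ℝ) * coulombCoord (m + 2) (i + 2) (cPhi m y))
      = (β / y i.succ + F * cB m i.succ * y i.succ) + F * y i.succ := by
    intro i
    rw [coord_mid]
    unfold cB
    rw [if_neg (Fin.succ_ne_zero i)]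
    push_cast [Fin.val_succ]
    ring
  rw [Finset.sum_congr rfl fun i _ => h i, Finset.sum_add_distrib, ← Finset.mul_sum]
  rw [Fin.sum_univ_succ (fun i => y i)]
  simp only [cB, if_true]
  push_cast
  ring

lemma dom_iff (m : ℕ) (y : Fin (m + 1) → ℝ) :
    cPhi m y ∈ coulombDomain (m + 2) ↔ (∀ i, 0 < y i) ∧ ∑ i, y i < 1 := by
  have hs := cPhi_sum m y
  unfold coulombDomain
  change (∀ i : Fin (m + 1), 0 < cPhi m y i ∧ cPhi m y i < 1) ∧ ∑ i : Fin (m + 1), cPhi m y i < 1 ↔ _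
  constructor
  · rintro ⟨h1, h2⟩
    have h0 := (h1 0).1
    rw [cPhi_zero] at h0
    refine ⟨fun i => ?_, by linarith⟩
    refine Fin.cases ?_ (fun i => ?_) i
    · linarith
    · exact (h1 i.succ).1
  · rintro ⟨h1, h2⟩
    have hle : ∀ i, y i ≤ ∑ i, y i := fun i =>
      Finset.single_le_sum (fun i _ => (h1 i).le) (Finset.mem_univ i)
    refine ⟨fun i => ?_, by have := h1 0; linarith⟩
    refine Fin.cases ?_ (fun i => ?_) i
    · rw [cPhi_zero]
      have := h1 0
      have := hle 0
      constructor <;> linarith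
    · rw [cPhi_succ]
      exact ⟨h1 _, lt_of_le_of_lt (hle _) h2⟩

lemma coulombInt_eq (β F : ℝ) (m : ℕ) (g : (Fin (m + 1) → ℝ) → ℝ) :
    coulombInt β F (m + 2) g
      = Real.exp (-F) * ∫ y : Fin (m + 1) → ℝ,
        g (cPhi m y) * (cW β (∑ i, y i) * ∏ i, cq β F m i (y i)) := by
  have hemb : MeasurableEmbedding (cPhi m) :=
    (MeasurableEquiv.ofInvolutive (cPhi m) (cPhi_inv m) (cPhi_mp m).measurable).measurableEmbedding
  have hD : MeasurableSet (cPhi m ⁻¹' coulombDomain (m + 2)) := by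
    have : cPhi m ⁻¹' coulombDomain (m + 2)
        = (⋂ i, {y | 0 < y i}) ∩ {y : Fin (m + 1) → ℝ | ∑ i, y i < 1} := by
      ext y
      rw [Set.mem_preimage, dom_iff]
      simp
    rw [this]
    refine MeasurableSet.inter (MeasurableSet.iInter fun i => ?_) ?_
    · exact measurableSet_lt measurable_const (measurable_pi_apply i)
    · exact measurableSet_lt (by fun_prop) measurable_const
  have h1 := (cPhi_mp m).setIntegral_preimage_emb hemb (fun x => g x *
    Real.exp (-(∑ k ∈ Finset.Icc 1 (m + 2), (β / coulombCoord (m + 2) k x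
      + F * (k : ℝ) * coulombCoord (m + 2) k x)))) (coulombDomain (m + 2))
  unfold coulombInt
  refine Eq.trans h1.symm ?_
  rw [← integral_indicator hD, ← integral_const_mul]
  congr 1
  funext y
  by_cases hy : y ∈ cPhi m ⁻¹' coulombDomain (m + 2)
  · rw [Set.indicator_of_mem hy]
    obtain ⟨hy1, hy2⟩ := (dom_iff m y).mp hy
    simp only [exponent]
    have : ∀ i, cq β F m i (y i) = Real.exp (-(β / y i + F * cB m i * y i)) := fun i => by
      unfold cq
      rw [Set.indicator_of_mem (show y i ∈ Set.Ioi 0 from hy1 i)]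
      rfl
    simp only [this]
    rw [← Real.exp_sum, cW, if_pos hy2, mul_left_comm, ← Real.exp_add, ← Real.exp_add]
    congr 2
    rw [Finset.sum_neg_distrib]
    ring
  · rw [Set.indicator_of_notMem hy]
    have hny : ¬ _ := fun h => hy ((dom_iff m y).mpr h)
    have : cW β (∑ i, y i) * ∏ i, cq β F m i (y i) = 0 := by
      by_cases h1 : ∀ i, 0 < y i
      · have : ¬ ∑ i, y i < 1 := fun h => hny ⟨h1, h⟩
        rw [cW, if_neg this, zero_mul]
      · push Not at h1
        obtain ⟨i, hi⟩ := h1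
        rw [Finset.prod_eq_zero (Finset.mem_univ i), mul_zero]
        unfold cq
        rw [Set.indicator_of_notMem]
        simpa using hi
    rw [this]; simp

lemma condMean_eq (β F : ℝ) (m k : ℕ) (hk : 2 ≤ k) (hkN : k ≤ m + 2) :
    ∃ j : Fin (m + 1), cB m j = (k : ℝ) - 1 ∧ condMean β (m + 2) F k =
      (∫ y : Fin (m + 1) → ℝ, y j * (cW β (∑ i, y i) * ∏ i, cq β F m i (y i))) /
      (∫ y : Fin (m + 1) → ℝ, cW β (∑ i, y i) * ∏ i, cq β F m i (y i)) := by
  have key : ∃ j : Fin (m + 1), cB m j = (k : ℝ) - 1 ∧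
      ∀ y, coulombCoord (m + 2) k (cPhi m y) = y j := by
    rcases hkN.eq_or_lt with rfl | h
    · refine ⟨0, ?_, coord_last m⟩
      simp only [cB, if_true]
      push_cast; ring
    · obtain ⟨i, rfl⟩ := Nat.exists_eq_add_of_le' hk
      refine ⟨(⟨i, by omega⟩ : Fin m).succ, ?_, fun y => coord_mid m y ⟨i, by omega⟩⟩
      unfold cB
      rw [if_neg (Fin.succ_ne_zero _)]
      simp
      ring
  obtain ⟨j, hj, hc⟩ := key
  refine ⟨j, hj, ?_⟩
  unfold condMean
  rw [coulombInt_eq, coulombInt_eq, mul_div_mul_left _ _ (Real.exp_pos _).ne']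
  simp only [hc, one_mul]

lemma cB_sum (m : ℕ) (h : ℝ → ℝ) :
    ∑ i, h (cB m i) = ∑ l ∈ Finset.range (m + 1), h ((l : ℝ) + 1) := by
  rw [Fin.sum_univ_succ, Finset.sum_range_succ, Finset.sum_range, add_comm]
  congr 1
  · refine Finset.sum_congr rfl fun i _ => ?_
    unfold cB
    rw [if_neg (Fin.succ_ne_zero i)]
    simp

lemma cB_ge (m : ℕ) (i : Fin (m + 1)) : 1 ≤ cB m i := by
  unfold cB
  split_ifs with h
  · have : (0:ℝ) ≤ m := Nat.cast_nonneg m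
    linarith
  · have : 1 ≤ (i : ℕ) := Nat.one_le_iff_ne_zero.mpr fun hi => h (Fin.ext hi)
    exact_mod_cast this

lemma sum_inv_sqrt (n : ℕ) :
    ∑ l ∈ Finset.range n, 1 / Real.sqrt ((l : ℝ) + 1) ≤ 2 * Real.sqrt n := by
  induction n with
  | zero => simp
  | succ n ih =>
    rw [Finset.sum_range_succ]
    have hn : (0:ℝ) ≤ n := Nat.cast_nonneg n
    have h0 : 0 < Real.sqrt ((n : ℝ) + 1) := Real.sqrt_pos.mpr (by linarith)
    have h1 : Real.sqrt ((n : ℝ) + 1) ^ 2 = n + 1 := Real.sq_sqrt (by linarith)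
    have h2 : Real.sqrt (n : ℝ) ^ 2 = n := Real.sq_sqrt hn
    have h3 : 1 / Real.sqrt ((n : ℝ) + 1)
        ≤ 2 * (Real.sqrt ((n : ℝ) + 1) - Real.sqrt n) := by
      rw [div_le_iff₀ h0]
      nlinarith [sq_nonneg (Real.sqrt ((n : ℝ) + 1) - Real.sqrt n)]
    push_cast
    linarith

lemma sqrt_diff {β a l : ℝ} (hβ : 0 < β) (ha : 1 ≤ a) (hl : 2 * |l| ≤ a) :
    |Real.sqrt (β / a) - Real.sqrt (β / (a + l))|
      ≤ Real.sqrt (2 * β * |l|) * a ^ (-(3:ℝ)/4) := by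
  have ha0 : 0 < a := by linarith
  have hl1 := neg_abs_le l
  have hal : a / 2 ≤ a + l := by linarith
  have hal0 : 0 < a + l := by linarith
  have hu : 0 ≤ β / a := by positivity
  have hv : 0 ≤ β / (a + l) := by positivity
  have h1 : |Real.sqrt (β / a) - Real.sqrt (β / (a + l))| ≤ Real.sqrt |β / a - β / (a + l)| := by
    apply Real.abs_le_sqrt
    have e1 := Real.sq_sqrt hu
    have e2 := Real.sq_sqrt hv
    have n1 := Real.sqrt_nonneg (β / a)
    have n2 := Real.sqrt_nonneg (β / (a + l))
    set p := Real.sqrt (β / a)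
    set q := Real.sqrt (β / (a + l))
    rw [← e1, ← e2, sq_sub_sq, abs_mul, ← sq_abs, sq, abs_of_nonneg (add_nonneg n1 n2)]
    refine mul_le_mul_of_nonneg_right ?_ (abs_nonneg _)
    rw [abs_le]; constructor <;> linarith
  have h2 : |β / a - β / (a + l)| ≤ 2 * β * |l| / a ^ 2 := by
    have : β / a - β / (a + l) = β * l / (a * (a + l)) := by field_simp; ring
    rw [this, abs_div, abs_mul, abs_of_pos hβ, abs_of_pos (mul_pos ha0 hal0),
      div_le_div_iff₀ (by positivity) (by positivity)]
    have : 0 ≤ β * |l| := by positivity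
    nlinarith [mul_nonneg this (mul_nonneg ha0.le (sub_nonneg.mpr hal))]
  refine h1.trans ((Real.sqrt_le_sqrt h2).trans ?_)
  rw [Real.sqrt_div' _ (by positivity), Real.sqrt_sq ha0.le, div_eq_mul_inv]
  refine mul_le_mul_of_nonneg_left ?_ (Real.sqrt_nonneg _)
  rw [← Real.rpow_neg_one]
  exact Real.rpow_le_rpow_of_exponent_le ha (by norm_num)

lemma term_bound {β K G l : ℝ} (hβ : 0 < β) (hK : 0 ≤ K) (hG : 0 < G) (hl : 1 ≤ l) :
    Real.sqrt (β / (G * l)) + K * (G * l) ^ (-(3:ℝ)/4)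
      ≤ (Real.sqrt β + K * G ^ (-(1:ℝ)/4)) / Real.sqrt G * (1 / Real.sqrt l) := by
  have hl0 : 0 < l := by linarith
  have hGl : 0 < G * l := by positivity
  have h1 : (G * l) ^ (-(3:ℝ)/4) ≤ G ^ (-(1:ℝ)/4) * (Real.sqrt G)⁻¹ * (Real.sqrt l)⁻¹ := by
    have : (G * l) ^ (-(3:ℝ)/4) = (G * l) ^ (-(1:ℝ)/4) * (Real.sqrt (G * l))⁻¹ := by
      rw [Real.sqrt_eq_rpow, ← Real.rpow_neg hGl.le, ← Real.rpow_add hGl]; norm_num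
    rw [this, Real.sqrt_mul hG.le, mul_inv, mul_assoc]
    refine mul_le_mul_of_nonneg_right ?_ (by positivity)
    exact Real.rpow_le_rpow_of_nonpos hG (by nlinarith) (by norm_num)
  have h2 : Real.sqrt (β / (G * l)) = Real.sqrt β * ((Real.sqrt G)⁻¹ * (Real.sqrt l)⁻¹) := by
    rw [Real.sqrt_div hβ.le, Real.sqrt_mul hG.le, div_eq_mul_inv, mul_inv]
  rw [h2]
  calc _ ≤ Real.sqrt β * ((Real.sqrt G)⁻¹ * (Real.sqrt l)⁻¹)
        + K * (G ^ (-(1:ℝ)/4) * (Real.sqrt G)⁻¹ * (Real.sqrt l)⁻¹) := by gcongr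
    _ = _ := by ring

lemma cq_int {β a : ℝ} (f : ℝ → ℝ) :
    (∫ t, f t * (Set.Ioi (0:ℝ)).indicator (cE β a) t)
      = ∫ t in Set.Ioi (0:ℝ), f t * cE β a t := by
  rw [← integral_indicator measurableSet_Ioi]
  congr 1
  funext t
  rw [Set.indicator_mul_right]

lemma cq_integrable {β a : ℝ} (f : ℝ → ℝ)
    (h : IntegrableOn (fun t => f t * cE β a t) (Set.Ioi 0)) :
    Integrable (fun t => f t * (Set.Ioi (0:ℝ)).indicator (cE β a) t) := by
  rw [← integrable_indicator_iff measurableSet_Ioi] at h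
  refine h.congr (ae_of_all _ fun t => ?_)
  simp only
  rw [Set.indicator_mul_right]

lemma main_bound {β F₀ δ : ℝ} (hβ : 0 < β) (hF : 0 < F₀) (hδ : 0 < δ) (hδ1 : δ < 1)
    (hs : Real.sqrt (4 * β / F₀) = 1 - 3 * δ) (m k : ℕ) (hk : 2 ≤ k) (hkN : k ≤ m + 2)
    (h1 : 1 ≤ F₀ * ((m + 2 : ℕ) : ℝ) * β)
    (h2 : 2 * (Real.sqrt β + 1 / 2) / Real.sqrt F₀ * (F₀ * ((m + 2 : ℕ) : ℝ)) ^ (-(1:ℝ)/4) ≤ δ) :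
    |condMean β (m + 2) (F₀ * ((m + 2 : ℕ) : ℝ)) k
      - Real.sqrt (β / (F₀ * ((m + 2 : ℕ) : ℝ) * ((k : ℝ) - 1)))|
      ≤ (Real.sqrt β + 1 / 2) * (F₀ * ((m + 2 : ℕ) : ℝ) * ((k : ℝ) - 1)) ^ (-(3:ℝ)/4)
        / (Real.exp (-(β / δ)) * δ) := by
  obtain ⟨j, hj, hc⟩ := condMean_eq β (F₀ * ((m + 2 : ℕ) : ℝ)) m k hk hkN
  rw [hc, ← hj]
  have hN : (0:ℝ) < ((m + 2 : ℕ) : ℝ) := by positivity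
  set G := F₀ * ((m + 2 : ℕ) : ℝ) with hG
  have hGpos : 0 < G := by positivity
  set K := Real.sqrt β + 1 / 2 with hK
  have hK0 : 0 ≤ K := by positivity
  have ha : ∀ i, 0 < G * cB m i := fun i => mul_pos hGpos (by linarith [cB_ge m i])
  refine abstract_bound hβ hδ hδ1 (cq β G m) (fun i => Real.sqrt (β / (G * cB m i)))
    (fun i => K * (G * cB m i) ^ (-(3:ℝ)/4)) ?_ ?_ ?_ ?_ ?_ ?_ ?_ j
  · intro i t
    exact Set.indicator_nonneg (fun t _ => (cE_pos _ _ _).le) t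
  · intro i t ht
    exact Set.indicator_of_notMem (by simpa using ht) _
  · intro i
    have := cq_integrable (β := β) (a := G * cB m i) (fun _ => 1)
      (by simpa using int_pow hβ (ha i) 0)
    simp only [one_mul] at this
    exact this
  · intro i
    exact cq_integrable (fun t => t) (by simpa using int_pow hβ (ha i) 1)
  · intro i
    have := cq_int (β := β) (a := G * cB m i) (fun _ => 1)
    simp only [one_mul] at this
    unfold cq
    rw [this]
    exact Z_pos hβ (ha i)
  · intro i
    have e1 := cq_int (β := β) (a := G * cB m i) (fun _ => 1)
    simp only [one_mul] at e1
    unfold cq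
    rw [e1, cq_int (fun t => |t - Real.sqrt (β / (G * cB m i))|)]
    refine one_dim hβ (ha i) ?_
    have hle : 1 ≤ G * cB m i * β := by
      have : G * β ≤ G * cB m i * β := by
        have := cB_ge m i
        have h : 0 < G * β := by positivity
        nlinarith
      linarith
    have : G * cB m i * Real.sqrt (β / (G * cB m i)) = Real.sqrt (G * cB m i * β) := by
      have hh := ha i
      set a := G * cB m i
      rw [Real.sqrt_div hβ.le, Real.sqrt_mul hh.le]
      have := Real.mul_self_sqrt hh.le
      have h0 : 0 < Real.sqrt a := Real.sqrt_pos.mpr hh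
      field_simp
      nlinarith
    rw [this]
    exact Real.one_le_sqrt.mpr hle
  · have hb := cB_sum m (fun l => Real.sqrt (β / (G * l)) + K * (G * l) ^ (-(3:ℝ)/4))
    refine (le_of_eq hb).trans ?_
    have hsq : Real.sqrt ((m + 1 : ℕ) : ℝ) ≤ Real.sqrt ((m + 2 : ℕ) : ℝ) :=
      Real.sqrt_le_sqrt (by push_cast; linarith)
    have hGs : Real.sqrt G = Real.sqrt F₀ * Real.sqrt ((m + 2 : ℕ) : ℝ) := Real.sqrt_mul hF.le _
    have hF0 : 0 < Real.sqrt F₀ := Real.sqrt_pos.mpr hF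
    have hN0 : 0 < Real.sqrt ((m + 2 : ℕ) : ℝ) := Real.sqrt_pos.mpr hN
    have hs4 : Real.sqrt (4 * β / F₀) = 2 * Real.sqrt β / Real.sqrt F₀ := by
      rw [Real.sqrt_div' _ hF.le, Real.sqrt_mul (by norm_num)]
      congr 2
      rw [show (4:ℝ) = 2 ^ 2 by norm_num, Real.sqrt_sq (by norm_num)]
    have hA : 0 ≤ (Real.sqrt β + K * G ^ (-(1:ℝ)/4)) / Real.sqrt G := by positivity
    calc _ ≤ ∑ l ∈ Finset.range (m + 1), (Real.sqrt β + K * G ^ (-(1:ℝ)/4)) / Real.sqrt G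
            * (1 / Real.sqrt ((l : ℝ) + 1)) := by
          refine Finset.sum_le_sum fun l _ => term_bound hβ hK0 hGpos ?_
          have : (0:ℝ) ≤ l := Nat.cast_nonneg l
          linarith
      _ = (Real.sqrt β + K * G ^ (-(1:ℝ)/4)) / Real.sqrt G
            * ∑ l ∈ Finset.range (m + 1), (1 / Real.sqrt ((l : ℝ) + 1)) := by
          rw [Finset.mul_sum]
      _ ≤ (Real.sqrt β + K * G ^ (-(1:ℝ)/4)) / Real.sqrt G
            * (2 * Real.sqrt ((m + 2 : ℕ) : ℝ)) := by
          refine mul_le_mul_of_nonneg_left ?_ hA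
          have := sum_inv_sqrt (m + 1)
          linarith
      _ = 2 * Real.sqrt β / Real.sqrt F₀ + 2 * K / Real.sqrt F₀ * G ^ (-(1:ℝ)/4) := by
          rw [hGs]; field_simp
      _ ≤ 1 - 2 * δ := by rw [← hs4, hs]; linarith

/-- Weak supercritical force `F = F₀N`, `F₀ > 4β`: for `k ≥ 2`,
`m_k(N,F₀N) = √(β/((k−1)F₀N + λ₀)) + O(log N/(kN)^{3/4})`. -/
theorem mean_spacing_supercritical (β F₀ l₀ : ℝ) (hβ : 0 < β) (hF₀ : 4 * β < F₀)
    (hl₀ : ∫ x in (0:ℝ)..1, x * Real.exp (l₀ * x - β / x)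
        = (1 - Real.sqrt (4 * β / F₀)) * ∫ x in (0:ℝ)..1, Real.exp (l₀ * x - β / x))
    (hl₀uniq : ∀ l : ℝ, (∫ x in (0:ℝ)..1, x * Real.exp (l * x - β / x)
        = (1 - Real.sqrt (4 * β / F₀)) * ∫ x in (0:ℝ)..1, Real.exp (l * x - β / x)) → l = l₀) :
    ∃ C > (0:ℝ), ∃ N₀ : ℕ, ∀ N ≥ N₀, ∀ k : ℕ, 2 ≤ k → k ≤ N →
      |condMean β N (F₀ * N) k - Real.sqrt (β / (((k : ℝ) - 1) * F₀ * N + l₀))| ≤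
        C * Real.log N / ((k : ℝ) * N) ^ ((3:ℝ)/4) := by
  
  have hF : 0 < F₀ := by linarith
  set δ := (1 - Real.sqrt (4 * β / F₀)) / 3 with hδdef
  have hs0 : 0 ≤ Real.sqrt (4 * β / F₀) := Real.sqrt_nonneg _
  have hs1 : Real.sqrt (4 * β / F₀) < 1 := by
    rw [Real.sqrt_lt' one_pos, div_lt_iff₀ hF]; linarith
  have hδ : 0 < δ := by rw [hδdef]; linarith
  have hδ1 : δ < 1 := by rw [hδdef]; linarith
  have hs : Real.sqrt (4 * β / F₀) = 1 - 3 * δ := by rw [hδdef]; ring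
  set c := Real.exp (-(β / δ)) * δ with hc
  have hcpos : 0 < c := mul_pos (Real.exp_pos _) hδ
  set K := Real.sqrt β + 1 / 2 with hK
  have hKpos : 0 < K := by positivity
  set M := K / c + Real.sqrt (2 * β * |l₀|) with hM
  have hMpos : 0 < M := by positivity
  have htop : Tendsto (fun N : ℕ => F₀ * (N : ℝ)) atTop atTop :=
    tendsto_natCast_atTop_atTop.const_mul_atTop hF
  have hε : Tendsto (fun N : ℕ => 2 * K / Real.sqrt F₀ * (F₀ * (N : ℝ)) ^ (-(1:ℝ)/4))
      atTop (nhds 0) := by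
    have h := (tendsto_rpow_neg_atTop (y := 1/4) (by norm_num)).comp htop
    have := h.const_mul (2 * K / Real.sqrt F₀)
    rw [mul_zero] at this
    refine this.congr fun N => ?_
    simp only [Function.comp]
    norm_num
  have hev : ∀ᶠ N : ℕ in atTop, 3 ≤ N ∧ 1 ≤ F₀ * (N : ℝ) ∧ 1 ≤ F₀ * (N : ℝ) * β ∧
      2 * |l₀| ≤ F₀ * (N : ℝ) ∧
      2 * K / Real.sqrt F₀ * (F₀ * (N : ℝ)) ^ (-(1:ℝ)/4) ≤ δ := by
    filter_upwards [eventually_ge_atTop 3, htop.eventually_ge_atTop 1,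
      (htop.atTop_mul_const hβ).eventually_ge_atTop 1, htop.eventually_ge_atTop (2 * |l₀|),
      hε.eventually_le_const hδ] with N a1 a2 a3 a4 a5
    exact ⟨a1, a2, a3, a4, a5⟩
  obtain ⟨N₀, hN₀⟩ := eventually_atTop.mp hev
  refine ⟨M * (F₀ / 2) ^ (-(3:ℝ)/4), by positivity, N₀, fun N hN k hk hkN => ?_⟩
  obtain ⟨a1, a2, a3, a4, a5⟩ := hN₀ N hN
  obtain ⟨m, rfl⟩ := Nat.exists_eq_add_of_le' (show 2 ≤ N by omega)
  have hb := main_bound hβ hF hδ hδ1 hs m k hk hkN a3 a5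
  have hkR : (2:ℝ) ≤ k := by exact_mod_cast hk
  set G := F₀ * ((m + 2 : ℕ) : ℝ) with hG
  have hGpos : 0 < G := by linarith
  have hGa : G ≤ G * ((k : ℝ) - 1) := by nlinarith
  have hd := sqrt_diff (l := l₀) hβ (a2.trans hGa) (a4.trans hGa)
  have hae : ((k : ℝ) - 1) * F₀ * ((m + 2 : ℕ) : ℝ) = G * ((k : ℝ) - 1) := by rw [hG]; ring
  rw [hae]
  set a := G * ((k : ℝ) - 1) with ha
  have htot : |condMean β (m + 2) G k - Real.sqrt (β / (a + l₀))| ≤ M * a ^ (-(3:ℝ)/4) := by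
    refine (abs_sub_le _ (Real.sqrt (β / a)) _).trans ((add_le_add hb hd).trans (le_of_eq ?_))
    rw [hM]; ring
  have hN0 : (0:ℝ) < ((m + 2 : ℕ) : ℝ) := by positivity
  have hkN0 : 0 < (k : ℝ) * ((m + 2 : ℕ) : ℝ) := by positivity
  have hpow : a ^ (-(3:ℝ)/4)
      ≤ (F₀ / 2) ^ (-(3:ℝ)/4) * (((k : ℝ) * ((m + 2 : ℕ) : ℝ)) ^ ((3:ℝ)/4))⁻¹ := by
    rw [← Real.rpow_neg hkN0.le, ← neg_div, ← Real.mul_rpow (by positivity) hkN0.le]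
    refine Real.rpow_le_rpow_of_nonpos (by positivity) ?_ (by norm_num)
    rw [ha, hG]
    have : 0 < F₀ * ((m + 2 : ℕ) : ℝ) := hGpos
    nlinarith
  have hlog : 1 ≤ Real.log ((m + 2 : ℕ) : ℝ) := by
    rw [Real.le_log_iff_exp_le hN0]
    have h3 : (3:ℝ) ≤ ((m + 2 : ℕ) : ℝ) := by exact_mod_cast a1
    linarith [Real.exp_one_lt_d9]
  have hX : 0 ≤ M * (F₀ / 2) ^ (-(3:ℝ)/4) * (((k : ℝ) * ((m + 2 : ℕ) : ℝ)) ^ ((3:ℝ)/4))⁻¹ := by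
    positivity
  refine htot.trans ((mul_le_mul_of_nonneg_left hpow hMpos.le).trans ?_)
  have hfin := mul_le_mul_of_nonneg_left hlog hX
  calc _ = _ := by ring
    _ ≤ _ := hfin
    _ = _ := by ring
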